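/- Weighted counting over a box by dyadic decomposition: let ℓ be a natural number, M a commutative additive monoid, θ : (Fin ℓ → ℕ) → M, and b, c : Fin ℓ → ℕ with b i ≤ c i for all i. Then the sum of θ(x) over all points x of the box ∏_{i : Fin ℓ} Ico(b i, c i) equals the sum, over all maximal-dyadic sub-boxes B of the box (i.e. all families (u i)_{i : Fin ℓ} with each u i a dyadic interval maximal in Ico(b i, c i)), of the sum of θ(x) over the points x of B. -/

import Mathlib

/-- A dyadic interval: a set of the form `Ico (2^p * q) (2^p * (q+1))`. -/
def IsDyadic (u : Set ℕ) : Prop :=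
  ∃ p q : ℕ, u = Set.Ico (2 ^ p * q) (2 ^ p * (q + 1))

/-- A dyadic interval `u` is maximal in `Ico b c` if `u ⊆ Ico b c` and no strictly
larger dyadic interval is contained in `Ico b c`. -/
def IsMaxDyadicIn (u : Set ℕ) (b c : ℕ) : Prop :=
  IsDyadic u ∧ u ⊆ Set.Ico b c ∧ ∀ v : Set ℕ, IsDyadic v → u ⊂ v → ¬ v ⊆ Set.Ico b c

theorem mem_Ico_two_pow_mul_iff {m p q : ℕ} :
    m ∈ Set.Ico (2 ^ p * q) (2 ^ p * (q + 1)) ↔ m / 2 ^ p = q := by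
  have hp : 0 < 2 ^ p := by positivity
  rw [Set.mem_Ico, Nat.div_eq_iff hp, mul_add, mul_one, mul_comm q]
  omega

theorem Ico_two_pow_mul_subset {m p q p' q' : ℕ} (hpp' : p ≤ p')
    (hm : m ∈ Set.Ico (2 ^ p * q) (2 ^ p * (q + 1)))
    (hm' : m ∈ Set.Ico (2 ^ p' * q') (2 ^ p' * (q' + 1))) :
    Set.Ico (2 ^ p * q) (2 ^ p * (q + 1)) ⊆ Set.Ico (2 ^ p' * q') (2 ^ p' * (q' + 1)) := by
  intro k hk
  obtain ⟨d, rfl⟩ := Nat.exists_eq_add_of_le hpp'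
  rw [mem_Ico_two_pow_mul_iff] at hm hm' hk ⊢
  rw [pow_add, ← Nat.div_div_eq_div_mul] at hm' ⊢
  rw [hk, ← hm, hm']

theorem IsDyadic.subset_or_subset {u v : Set ℕ} (hu : IsDyadic u) (hv : IsDyadic v) {m : ℕ}
    (hmu : m ∈ u) (hmv : m ∈ v) : u ⊆ v ∨ v ⊆ u := by
  obtain ⟨p, q, rfl⟩ := hu
  obtain ⟨p', q', rfl⟩ := hv
  exact (le_total p p').imp (Ico_two_pow_mul_subset · hmu hmv) (Ico_two_pow_mul_subset · hmv hmu)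

theorem isDyadic_singleton (m : ℕ) : IsDyadic {m} :=
  ⟨0, m, by ext k; simp; omega⟩

theorem IsMaxDyadicIn.eq_of_subset {u v : Set ℕ} {b c : ℕ} (hu : IsMaxDyadicIn u b c)
    (hv : IsMaxDyadicIn v b c) (huv : u ⊆ v) : u = v :=
  by_contra fun hne => hu.2.2 v hv.1 (huv.ssubset_of_ne hne) hv.2.1

theorem IsMaxDyadicIn.eq_of_mem {u v : Set ℕ} {b c m : ℕ} (hu : IsMaxDyadicIn u b c)
    (hv : IsMaxDyadicIn v b c) (hmu : m ∈ u) (hmv : m ∈ v) : u = v :=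
  (hu.1.subset_or_subset hv.1 hmu hmv).elim (hu.eq_of_subset hv)
    fun hvu => (hv.eq_of_subset hu hvu).symm

theorem exists_isMaxDyadicIn_mem {b c m : ℕ} (hm : m ∈ Set.Ico b c) :
    ∃ u, IsMaxDyadicIn u b c ∧ m ∈ u := by
  have hfin : {u | IsDyadic u ∧ u ⊆ Set.Ico b c}.Finite :=
    (Set.finite_Ico b c).finite_subsets.subset fun _ hu => hu.2
  obtain ⟨u, hmu, hu⟩ := hfin.exists_le_maximal
    ⟨isDyadic_singleton m, Set.singleton_subset_iff.2 hm⟩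
  exact ⟨u, ⟨hu.prop.1, hu.prop.2, fun v hv huv hvbc => hu.not_prop_of_gt huv ⟨hv, hvbc⟩⟩,
    Set.singleton_subset_iff.1 hmu⟩

/-- Weighted counting over a box by dyadic decomposition: the sum of `θ` over the box
`∏ i, Ico (b i) (c i)` equals the sum, over all maximal-dyadic sub-boxes, of the sum
of `θ` over the sub-box. -/
theorem sum_box_eq_sum_maxDyadic_subboxes (ℓ : ℕ) {M : Type*} [AddCommMonoid M]
    (θ : (Fin ℓ → ℕ) → M) (b c : Fin ℓ → ℕ) (h : ∀ i, b i ≤ c i) :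
    ∑ᶠ x ∈ Set.univ.pi fun i => Set.Ico (b i) (c i), θ x =
      ∑ᶠ u ∈ {u : Fin ℓ → Set ℕ | ∀ i, IsMaxDyadicIn (u i) (b i) (c i)},
        ∑ᶠ x ∈ Set.univ.pi u, θ x := by
  have hbox : (Set.univ.pi fun i => Set.Ico (b i) (c i)) =
      ⋃ u ∈ {u : Fin ℓ → Set ℕ | ∀ i, IsMaxDyadicIn (u i) (b i) (c i)}, Set.univ.pi u := by
    ext x
    simp only [Set.mem_iUnion, Set.mem_univ_pi, Set.mem_ofPred_eq, exists_prop]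
    constructor
    · intro hx
      choose u hu hxu using fun i => exists_isMaxDyadicIn_mem (hx i)
      exact ⟨u, hu, hxu⟩
    · rintro ⟨u, hu, hxu⟩ i
      exact (hu i).2.1 (hxu i)
  rw [hbox]
  refine finsum_mem_biUnion ?_ ?_ ?_
  · intro u hu v hv huv
    refine Set.disjoint_left.2 fun x hxu hxv => huv (funext fun i => ?_)
    exact (hu i).eq_of_mem (hv i) (hxu i trivial) (hxv i trivial)
  · exact (Set.Finite.pi fun i => (Set.finite_Ico (b i) (c i)).finite_subsets).subset
      fun u hu i _ => (hu i).2.1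
  · exact fun u hu => Set.Finite.pi fun i => (Set.finite_Ico (b i) (c i)).subset (hu i).2.1
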